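/- There are no integers q ≥ 2 and d ≥ 4 and prime number p satisfying 2p(q² − 1)(q − 1) = (q^d − 1)(q^{d−1} − 1) together with either p(q − 1) = q^{d−1} − 1 or the condition that p divides (q^d − 1)/(q − 1). -/

import Mathlib

/-- There are no integers `q ≥ 2`, `d ≥ 4` and prime `p` with
`2p(q² - 1)(q - 1) = (q^d - 1)(q^{d-1} - 1)` such that either
`p(q - 1) = q^{d-1} - 1` or `p` divides `(q^d - 1)/(q - 1)`. -/
theorem psl_two_spaces_degree_ne :
    ¬ ∃ (q d p : ℕ), 2 ≤ q ∧ 4 ≤ d ∧ p.Prime ∧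
      2 * p * ((q ^ 2 - 1) * (q - 1)) = (q ^ d - 1) * (q ^ (d - 1) - 1) ∧
      (p * (q - 1) = q ^ (d - 1) - 1 ∨ p ∣ (q ^ d - 1) / (q - 1)) := by
  rintro ⟨q, d, p, hq, hd, hp, h, hor⟩
  have hq1 : 0 < q - 1 := by omega
  have hpq : 0 < p * (q - 1) := Nat.mul_pos hp.pos hq1
  have hsq : 1 ≤ q ^ 2 := Nat.one_le_pow _ _ (by omega)
  have hcube : 2 * (q ^ 2 - 1) < q ^ 3 - 1 := by
    have : 2 * q ^ 2 ≤ q ^ 3 := by nlinarith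
    omega
  have hd_sub_one : q ^ 3 ≤ q ^ (d - 1) := Nat.pow_le_pow_right (by omega) (by omega)
  have hd_pow : q ^ 3 ≤ q ^ d := Nat.pow_le_pow_right (by omega) (by omega)
  rcases hor with h1 | h2
  · have : 2 * (q ^ 2 - 1) = q ^ d - 1 := by
      apply Nat.eq_of_mul_eq_mul_right hpq
      rw [← h1] at h
      linarith
    omega
  · have hdvd : q - 1 ∣ q ^ d - 1 := by simpa using Nat.sub_dvd_pow_sub_pow q 1 d
    obtain ⟨k, hk⟩ := h2
    have hfac : q ^ d - 1 = (q - 1) * (p * k) := by rw [← hk, Nat.mul_div_cancel' hdvd]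
    have heq : 2 * (q ^ 2 - 1) = k * (q ^ (d - 1) - 1) := by
      apply Nat.eq_of_mul_eq_mul_right hpq
      rw [hfac] at h
      linarith
    have hk_pos : 0 < k := by
      rcases Nat.eq_zero_or_pos k with rfl | hk_pos
      · simp only [mul_zero] at hfac
        omega
      · exact hk_pos
    have := Nat.le_mul_of_pos_left (q ^ (d - 1) - 1) hk_pos
    omega
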